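/- Let λ > 0, μ > 0 real, γ real, and let s be a complex number with Re(γ + s) > 0 such that z − μ is not an integer, where z := (γ+s)/2. Then ∫_0^∞ x^{γ+s−1} e^{−λx²} (1+x²)^{−μ} dx = (1/2)·[ (Γ(z)Γ(μ−z)/Γ(μ)) · ∑_{n=0}^∞ (z)_n λ^n / ((1+z−μ)_n n!) + λ^{μ−z} Γ(z−μ) · ∑_{n=0}^∞ (μ)_n λ^n / ((1−z+μ)_n n!) ], where both series converge absolutely. (This is the splitting H(s) = (H₁(s)+H₂(s))/2 of the Mellin transform of x^γ e^{−λx²}(1+x²)^{−μ} into confluent hypergeometric ₁F₁ series.) -/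

import Mathlib

open Real

namespace MTS

open Filter Topology MeasureTheory

/-- coefficients -/
noncomputable def g (a c : ℂ) (n : ℕ) : ℂ :=
  (-1) ^ n / (n.factorial : ℂ) * Complex.Gamma (a + n) * Complex.Gamma (c - n)

noncomputable def Phi (a c x : ℂ) : ℂ := ∑' n : ℕ, g a c n * x ^ n

def NI (c : ℂ) : Prop := ∀ n : ℤ, c ≠ (n : ℂ)

lemma NI.add_one {c : ℂ} (h : NI c) : NI (c + 1) := by
  intro n hn
  apply h (n - 1)
  push_cast
  rw [← hn]; ring

lemma NI.sub_one {c : ℂ} (h : NI c) : NI (c - 1) := by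
  intro n hn
  apply h (n + 1)
  push_cast
  rw [← hn]; ring

lemma NI.neg {c : ℂ} (h : NI c) : NI (-c) := by
  intro n hn
  apply h (-n)
  push_cast
  rw [← hn]; ring

lemma NI.ne_nat {c : ℂ} (h : NI c) (n : ℕ) : c - n ≠ 0 := by
  intro hn
  apply h n
  push_cast
  linear_combination hn

lemma NI.ne_zero {c : ℂ} (h : NI c) : c ≠ 0 := by
  simpa using h 0

lemma add_nat_ne {a : ℂ} (ha : 0 < a.re) (n : ℕ) : a + n ≠ 0 := by
  intro h
  have := congrArg Complex.re h
  simp at this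
  have : (0:ℝ) ≤ n := n.cast_nonneg
  linarith

lemma g_ii {a : ℂ} (c : ℂ) (ha : 0 < a.re) (n : ℕ) : (a + n) * g a c n = g (a + 1) c n := by
  unfold g
  rw [show a + 1 + (n : ℂ) = (a + n) + 1 by ring, Complex.Gamma_add_one _ (add_nat_ne ha n)]
  ring

lemma g_i (a : ℂ) {c : ℂ} (hc : NI c) (n : ℕ) : (c - n) * g a c n = g a (c + 1) n := by
  unfold g
  rw [show c + 1 - (n : ℂ) = (c - n) + 1 by ring, Complex.Gamma_add_one _ (hc.ne_nat n)]
  ring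

lemma g_succ (a c : ℂ) (n : ℕ) : ((n + 1 : ℕ) : ℂ) * g a c (n + 1) = - g (a + 1) (c - 1) n := by
  unfold g
  rw [show a + 1 + (n : ℂ) = a + ((n + 1 : ℕ) : ℂ) by push_cast; ring,
    show c - 1 - (n : ℂ) = c - ((n + 1 : ℕ) : ℂ) by push_cast; ring, Nat.factorial_succ]
  have h1 : ((n + 1 : ℕ) : ℂ) ≠ 0 := by exact_mod_cast Nat.succ_ne_zero n
  have h2 : (n.factorial : ℂ) ≠ 0 := by exact_mod_cast Nat.factorial_ne_zero n
  push_cast at *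
  field_simp
  ring

lemma g_ratio {a c : ℂ} (ha : 0 < a.re) (hc : NI c) (n : ℕ) :
    g a c (n + 1) * ((n + 1 : ℕ) : ℂ) * (c - ((n + 1 : ℕ) : ℂ)) = - ((a + n) * g a c n) := by
  have h1 := g_succ a c n
  have h2 := g_i (a + 1) hc.sub_one n
  have h3 := g_ii c ha n
  rw [show c - 1 + 1 = c by ring] at h2
  push_cast at *
  linear_combination (c - 1 - n) * h1 - h2 + h3

lemma summable_g {a c : ℂ} (ha : 0 < a.re) (hc : NI c) (x : ℂ) :
    Summable (fun n : ℕ => g a c n * x ^ n) := by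
  refine summable_of_ratio_norm_eventually_le (r := 1 / 2) (by norm_num) ?_
  obtain ⟨N, hN⟩ := exists_nat_gt (2 * ‖c‖ + ‖a‖ + 4 + 8 * ‖x‖)
  filter_upwards [eventually_ge_atTop N] with n hn
  have hnR : (2 * ‖c‖ + ‖a‖ + 4 + 8 * ‖x‖) < (n : ℝ) := hN.trans_le (by exact_mod_cast hn)
  have hr := congrArg norm (g_ratio ha hc n)
  rw [norm_neg, norm_mul, norm_mul, norm_mul, Complex.norm_natCast] at hr
  push_cast at hr
  have h1 : ‖a + n‖ ≤ ‖a‖ + n := (norm_add_le _ _).trans (by simp)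
  have h2 : (n : ℝ) + 1 - ‖c‖ ≤ ‖c - (n + 1)‖ := by
    have := norm_sub_norm_le ((n : ℂ) + 1) c
    rw [norm_sub_rev] at this
    have h3 : ‖(n : ℂ) + 1‖ = n + 1 := by
      have := Complex.norm_natCast (n + 1)
      push_cast at this; exact this
    linarith
  have hx := norm_nonneg x
  have ha' := norm_nonneg a
  have hc' := norm_nonneg c
  have hg := norm_nonneg (g a c n)
  have hg1 := norm_nonneg (g a c (n + 1))
  have h4 : ‖g a c (n + 1)‖ * (n + 1) * ((n + 1) / 2) ≤ 2 * (n + 1) * ‖g a c n‖ := by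
    calc _ ≤ ‖g a c (n + 1)‖ * (n + 1) * ‖c - (n + 1)‖ := by
          gcongr; linarith
      _ = ‖a + n‖ * ‖g a c n‖ := hr
      _ ≤ _ := by gcongr; linarith
  have h5 : ‖g a c (n + 1)‖ * (n + 1) ≤ 4 * ‖g a c n‖ := by
    have : (0:ℝ) < n + 1 := by positivity
    by_contra hcon
    push Not at hcon
    nlinarith
  rw [norm_mul, norm_mul, pow_succ, norm_mul]
  have h6 : ‖g a c (n + 1)‖ * ‖x‖ ≤ 1 / 2 * ‖g a c n‖ := by
    have h7 : ‖g a c (n + 1)‖ * (8 * ‖x‖) ≤ ‖g a c (n + 1)‖ * (n + 1) := by gcongr; linarith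
    linarith
  calc _ = (‖g a c (n + 1)‖ * ‖x‖) * ‖x ^ n‖ := by ring
    _ ≤ (1 / 2 * ‖g a c n‖) * ‖x ^ n‖ := by gcongr
    _ = _ := by ring

lemma hs_congr {f f' : ℕ → ℂ} {s s' : ℂ} (h : HasSum f s) (hf : ∀ n, f' n = f n) (hs : s' = s) :
    HasSum f' s' := by
  have e : f' = f := funext hf
  rw [e, hs]; exact h

lemma hasSum_nat_mul {a c : ℂ} (ha : 0 < a.re) (hc : NI c) (x : ℂ) :
    HasSum (fun n : ℕ => (n : ℂ) * g a c n * x ^ n) (- (x * Phi (a + 1) (c - 1) x)) := by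
  have h := (summable_g (a := a + 1) (c := c - 1) (by simp; linarith) hc.sub_one x).hasSum
  have h2 := (h.mul_left (-x))
  refine (hasSum_nat_add_iff' 1).mp ?_
  simp only [Finset.sum_range_one, Nat.cast_zero, zero_mul, sub_zero]
  refine hs_congr h2 (fun n => ?_) ?_
  · rw [g_succ]; ring
  · rw [Phi]; ring

lemma hasSum_Phi {a c : ℂ} (ha : 0 < a.re) (hc : NI c) (x : ℂ) :
    HasSum (fun n : ℕ => g a c n * x ^ n) (Phi a c x) := (summable_g ha hc x).hasSum

lemma Phi_i {a c : ℂ} (ha : 0 < a.re) (hc : NI c) (x : ℂ) :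
    c * Phi a c x + x * Phi (a + 1) (c - 1) x = Phi a (c + 1) x := by
  have h1 := ((hasSum_Phi ha hc x).mul_left c).sub (hasSum_nat_mul ha hc x)
  have h2 := hasSum_Phi ha hc.add_one x
  rw [sub_neg_eq_add] at h1
  refine h1.unique ?_
  refine hs_congr h2 (fun n => ?_) rfl
  rw [← g_i a hc]; ring

lemma Phi_ii {a c : ℂ} (ha : 0 < a.re) (hc : NI c) (x : ℂ) :
    a * Phi a c x - x * Phi (a + 1) (c - 1) x = Phi (a + 1) c x := by
  have h1 := ((hasSum_Phi ha hc x).mul_left a).add (hasSum_nat_mul ha hc x)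
  have h2 := hasSum_Phi (a := a + 1) (by simp; linarith) hc x
  rw [← sub_eq_add_neg] at h1
  refine h1.unique ?_
  refine hs_congr h2 (fun n => ?_) rfl
  rw [← g_ii c ha]; ring

lemma hasDerivAt_Phi {a c : ℂ} (ha : 0 < a.re) (hc : NI c) (x : ℂ) :
    HasDerivAt (Phi a c) (- Phi (a + 1) (c - 1) x) x := by
  set R : ℝ := ‖x‖ + 1 with hR
  have hR0 : 0 < R := by positivity
  have hs : Summable (fun n : ℕ => ‖(n : ℂ) * g a c n * (R : ℂ) ^ n‖ / R) :=
    ((hasSum_nat_mul ha hc R).summable.norm).div_const R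
  have key := hasDerivAt_tsum_of_isPreconnected (𝕜 := ℂ) (t := Metric.ball 0 R)
    (g := fun n y => g a c n * y ^ n)
    (g' := fun n y => g a c n * (n * y ^ (n - 1))) (y₀ := 0) (y := x) hs Metric.isOpen_ball
    (convex_ball _ _).isPreconnected
    (fun n y _ => (hasDerivAt_pow n y).const_mul _) ?_ (by simpa using hR0) (summable_g ha hc 0)
    (by simp [hR])
  · have e : (∑' n : ℕ, g a c n * ((n : ℂ) * x ^ (n - 1))) = - Phi (a + 1) (c - 1) x := by
      have h := (hasSum_Phi (a := a + 1) (c := c - 1) (by simp; linarith) hc.sub_one x).neg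
      refine HasSum.tsum_eq ?_
      refine (hasSum_nat_add_iff' 1).mp ?_
      simp only [Finset.sum_range_one, Nat.cast_zero, zero_mul, mul_zero, sub_zero]
      convert h using 2 with n
      have := g_succ a c n
      simp only [Nat.add_sub_cancel]
      linear_combination x ^ n * this
    rw [e] at key
    exact key
  · intro n y hy
    rw [mem_ball_zero_iff] at hy
    rcases n with _ | n
    · simp
    · rw [le_div_iff₀ hR0]
      simp only [norm_mul, norm_pow, Nat.add_sub_cancel, Complex.norm_real, Real.norm_eq_abs,
        abs_of_pos hR0]
      calc _ ≤ ‖g a c (n + 1)‖ * (‖((n + 1 : ℕ) : ℂ)‖ * R ^ n) * R := by gcongr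
        _ = _ := by ring

lemma continuous_Phi {a c : ℂ} (ha : 0 < a.re) (hc : NI c) : Continuous (Phi a c) :=
  continuous_iff_continuousAt.2 fun x => (hasDerivAt_Phi ha hc x).continuousAt

lemma Phi_zero (a c : ℂ) : Phi a c 0 = Complex.Gamma a * Complex.Gamma c := by
  unfold Phi
  rw [tsum_eq_single 0]
  · simp [g]
  · intro n hn; simp [hn]

lemma g_poch {a c : ℂ} (ha : 0 < a.re) (hc : NI c) (n : ℕ) :
    g a c n = Complex.Gamma a * Complex.Gamma c * ((ascPochhammer ℂ n).eval a /
      ((ascPochhammer ℂ n).eval (1 - c) * (n.factorial : ℂ))) := by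
  have key : (ascPochhammer ℂ n).eval (1 - c) ≠ 0 ∧
    g a c n * ((ascPochhammer ℂ n).eval (1 - c) * (n.factorial : ℂ)) =
      Complex.Gamma a * Complex.Gamma c * (ascPochhammer ℂ n).eval a := by
    induction n with
    | zero => simp [g]
    | succ n ih =>
      obtain ⟨ih0, ih⟩ := ih
      have hr := g_ratio ha hc n
      have hne : (1 - c + n) ≠ 0 := by
        have := hc.ne_nat (n + 1)
        intro h; apply this; push_cast; linear_combination -h
      rw [ascPochhammer_succ_eval, ascPochhammer_succ_eval, Nat.factorial_succ]
      refine ⟨mul_ne_zero ih0 hne, ?_⟩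
      push_cast at *
      linear_combination (a + n) * ih - (ascPochhammer ℂ n).eval (1 - c) * (n.factorial : ℂ) * hr
  have h2 : (n.factorial : ℂ) ≠ 0 := by exact_mod_cast Nat.factorial_ne_zero n
  rw [← mul_div_assoc, eq_div_iff (mul_ne_zero key.1 h2), key.2]

end MTS

namespace MTS

open Filter Topology MeasureTheory

noncomputable def ker (z : ℂ) (μ lam t : ℝ) : ℂ :=
  (t : ℂ) ^ (z - 1) * ((Real.exp (-lam * t) : ℝ) : ℂ) * (((1 + t) ^ (-μ) : ℝ) : ℂ)

noncomputable def F (z : ℂ) (μ lam : ℝ) : ℂ := ∫ t in Set.Ioi (0 : ℝ), ker z μ lam t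

lemma measurable_ker (z : ℂ) (μ lam : ℝ) : Measurable (ker z μ lam) := by
  unfold ker
  fun_prop

lemma norm_ker (z : ℂ) (μ lam : ℝ) {t : ℝ} (ht : 0 < t) :
    ‖ker z μ lam t‖ = t ^ (z.re - 1) * Real.exp (-lam * t) * (1 + t) ^ (-μ) := by
  unfold ker
  rw [norm_mul, norm_mul, Complex.norm_cpow_eq_rpow_re_of_pos ht, Complex.norm_real,
    Complex.norm_real, Real.norm_of_nonneg (Real.exp_pos _).le,
    Real.norm_of_nonneg (by positivity)]
  simp

lemma one_add_rpow_le {μ t : ℝ} (hμ : 0 < μ) (ht : 0 < t) : (1 + t) ^ (-μ) ≤ 1 :=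
  Real.rpow_le_one_of_one_le_of_nonpos (by linarith) (by linarith)

lemma integrableOn_rpow_exp {s b : ℝ} (hs : 0 < s) (hb : 0 < b) :
    IntegrableOn (fun t : ℝ => t ^ (s - 1) * Real.exp (-b * t)) (Set.Ioi 0) := by
  have := integrableOn_rpow_mul_exp_neg_mul_rpow (p := 1) (s := s - 1) (b := b)
    (by linarith) one_pos hb
  simpa using this

lemma integrable_ker {z : ℂ} {μ lam : ℝ} (hz : 0 < z.re) (hμ : 0 < μ) (hl : 0 < lam) :
    IntegrableOn (ker z μ lam) (Set.Ioi 0) := by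
  refine Integrable.mono' (integrableOn_rpow_exp hz hl)
    (measurable_ker z μ lam).aestronglyMeasurable ?_
  filter_upwards [ae_restrict_mem measurableSet_Ioi] with t ht
  have ht : 0 < t := ht
  rw [norm_ker _ _ _ ht]
  exact mul_le_of_le_one_right (by positivity) (one_add_rpow_le hμ ht)

lemma ker_succ (z : ℂ) (μ lam : ℝ) {t : ℝ} (ht : 0 < t) :
    ker (z + 1) μ lam t = t * ker z μ lam t := by
  unfold ker
  have : (t : ℂ) ≠ 0 := by exact_mod_cast ht.ne'
  rw [show z + 1 - 1 = (z - 1) + 1 by ring, Complex.cpow_add _ _ this, Complex.cpow_one]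
  ring

lemma ker_mu (z : ℂ) (μ lam : ℝ) {t : ℝ} (ht : 0 < t) :
    ker z μ lam t = ker z (μ + 1) lam t + ker (z + 1) (μ + 1) lam t := by
  rw [ker_succ _ _ _ ht]
  unfold ker
  have h : (1 + t) ^ (-μ) = (1 + t) ^ (-(μ + 1)) * (1 + t) := by
    conv_rhs => rw [← Real.rpow_add_one (by linarith)]
    congr 1; ring
  rw [h]; push_cast; ring

lemma F_mu {z : ℂ} {μ lam : ℝ} (hz : 0 < z.re) (hμ : 0 < μ) (hl : 0 < lam) :
    F z μ lam = F z (μ + 1) lam + F (z + 1) (μ + 1) lam := by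
  unfold F
  rw [← integral_add (integrable_ker hz (by linarith) hl)
    (integrable_ker (by simp; linarith) (by linarith) hl)]
  exact setIntegral_congr_fun measurableSet_Ioi fun t ht => ker_mu z μ lam ht

lemma hasDerivAt_F {z : ℂ} {μ lam : ℝ} (hz : 0 < z.re) (hμ : 0 < μ) (hl : 0 < lam) :
    HasDerivAt (F z μ) (- F (z + 1) μ lam) lam := by
  have hz1 : 0 < (z + 1).re := by simp; linarith
  have key := hasDerivAt_integral_of_dominated_loc_of_deriv_le (𝕜 := ℝ)
    (μ := volume.restrict (Set.Ioi (0 : ℝ))) (F := fun l t => ker z μ l t) (x₀ := lam)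
    (s := Set.Ioi (lam / 2)) (F' := fun l t => - ker (z + 1) μ l t)
    (bound := fun t => t ^ ((z + 1).re - 1) * Real.exp (-(lam / 2) * t))
    (Ioi_mem_nhds (by linarith))
    (Eventually.of_forall fun l => (measurable_ker z μ l).aestronglyMeasurable)
    (integrable_ker hz hμ hl)
    (measurable_ker _ _ _).neg.aestronglyMeasurable ?_
    (integrableOn_rpow_exp hz1 (by linarith)) ?_
  · have := key.2
    rw [integral_neg] at this
    exact this
  · filter_upwards [ae_restrict_mem measurableSet_Ioi] with t ht l hl'
    have ht : 0 < t := ht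
    have hl' : lam / 2 < l := hl'
    rw [norm_neg, norm_ker _ _ _ ht]
    refine (mul_le_of_le_one_right (by positivity) (one_add_rpow_le hμ ht)).trans ?_
    gcongr
  · filter_upwards [ae_restrict_mem measurableSet_Ioi] with t ht l hl'
    have ht : 0 < t := ht
    rw [ker_succ _ _ _ ht]
    unfold ker
    have h1 : HasDerivAt (fun l : ℝ => Real.exp (-l * t)) (Real.exp (-l * t) * (-1 * t)) l :=
      (((hasDerivAt_id l).neg).mul_const t).exp
    have h2 := ((h1.ofReal_comp).const_mul ((t : ℂ) ^ (z - 1))).mul_const (((1 + t) ^ (-μ) : ℝ) : ℂ)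
    refine h2.congr_deriv ?_
    push_cast; ring

lemma F_scale {w : ℂ} {μ lam : ℝ} (hl : 0 < lam) :
    (lam : ℂ) ^ (w - μ) * F w μ lam =
      ∫ u in Set.Ioi (0 : ℝ), (u : ℂ) ^ (w - 1) * ((Real.exp (-u) : ℝ) : ℂ) *
        (((lam + u) ^ (-μ) : ℝ) : ℂ) := by
  have h := integral_comp_mul_left_Ioi (fun u : ℝ => (u : ℂ) ^ (w - 1) *
    ((Real.exp (-u) : ℝ) : ℂ) * (((lam + u) ^ (-μ) : ℝ) : ℂ)) 0 hl
  have hl0 : (lam : ℂ) ≠ 0 := by exact_mod_cast hl.ne'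
  rw [mul_zero] at h
  have e : (∫ u in Set.Ioi (0 : ℝ), (u : ℂ) ^ (w - 1) * ((Real.exp (-u) : ℝ) : ℂ) *
        (((lam + u) ^ (-μ) : ℝ) : ℂ)) = (lam : ℂ) * (lam⁻¹ • ∫ u in Set.Ioi (0 : ℝ), (u : ℂ) ^ (w - 1) * ((Real.exp (-u) : ℝ) : ℂ) *
        (((lam + u) ^ (-μ) : ℝ) : ℂ)) := by
    rw [Complex.real_smul]; push_cast; field_simp
  rw [e, ← h]
  unfold F
  rw [← integral_const_mul, ← integral_const_mul]
  refine setIntegral_congr_fun measurableSet_Ioi fun t ht => ?_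
  have ht : 0 < t := ht
  simp only [ker]
  rw [show lam + lam * t = lam * (1 + t) by ring, Real.mul_rpow hl.le (by linarith),
    Complex.ofReal_mul, Complex.mul_cpow_ofReal_nonneg hl.le ht.le,
    show w - (μ : ℂ) = 1 + (w - 1) + ((-μ : ℝ) : ℂ) by push_cast; ring,
    Complex.cpow_add _ _ hl0, Complex.cpow_add _ _ hl0, Complex.cpow_one,
    Complex.ofReal_mul, Complex.ofReal_cpow hl.le, neg_mul]
  ring

lemma tendsto_F_scale {w : ℂ} {μ : ℝ} (hμ : 0 < μ) (hw : 0 < (w - μ).re) :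
    Tendsto (fun lam : ℝ => (lam : ℂ) ^ (w - μ) * F w μ lam) (𝓝[>] 0)
      (𝓝 (Complex.Gamma (w - μ))) := by
  have hw' : 0 < w.re - μ := by simpa using hw
  rw [Complex.Gamma_eq_integral hw, Complex.GammaIntegral]
  have e : ∀ᶠ lam : ℝ in 𝓝[>] 0, (∫ u in Set.Ioi (0 : ℝ), (u : ℂ) ^ (w - 1) *
        ((Real.exp (-u) : ℝ) : ℂ) * (((lam + u) ^ (-μ) : ℝ) : ℂ)) =
        (lam : ℂ) ^ (w - μ) * F w μ lam := by
    filter_upwards [self_mem_nhdsWithin] with lam hl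
    exact (F_scale hl).symm
  refine Tendsto.congr' e ?_
  refine tendsto_integral_filter_of_dominated_convergence
    (fun t => t ^ ((w.re - μ) - 1) * Real.exp (-1 * t)) ?_ ?_ (integrableOn_rpow_exp hw' one_pos) ?_
  · refine Eventually.of_forall fun l => Measurable.aestronglyMeasurable ?_
    fun_prop
  · filter_upwards [self_mem_nhdsWithin] with lam hl
    have hl : 0 < lam := hl
    filter_upwards [ae_restrict_mem measurableSet_Ioi] with t ht
    have ht : 0 < t := ht
    rw [norm_mul, norm_mul, Complex.norm_cpow_eq_rpow_re_of_pos ht, Complex.norm_real,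
      Complex.norm_real, Real.norm_of_nonneg (Real.exp_pos _).le,
      Real.norm_of_nonneg (by positivity)]
    have h1 : (lam + t) ^ (-μ) ≤ t ^ (-μ) :=
      Real.rpow_le_rpow_of_nonpos ht (by linarith) (by linarith)
    calc _ ≤ t ^ (w - 1).re * rexp (-t) * t ^ (-μ) := by gcongr
      _ = (t ^ (w - 1).re * t ^ (-μ)) * rexp (-t) := by ring
      _ = _ := by
        rw [← Real.rpow_add ht]
        simp only [Complex.sub_re, Complex.one_re]
        congr 2 <;> ring
  · filter_upwards [ae_restrict_mem measurableSet_Ioi] with t ht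
    have ht : 0 < t := ht
    have ht0 : (t : ℂ) ≠ 0 := by exact_mod_cast ht.ne'
    have h1 : Tendsto (fun lam : ℝ => (lam + t) ^ (-μ)) (𝓝[>] 0) (𝓝 (t ^ (-μ))) := by
      have : ContinuousAt (fun lam : ℝ => (lam + t) ^ (-μ)) 0 := by
        apply ContinuousAt.rpow_const (by fun_prop)
        left; simp [ht.ne']
      have h := this.tendsto
      rw [zero_add] at h
      exact h.mono_left nhdsWithin_le_nhds
    have h2 := ((Complex.continuous_ofReal.tendsto _).comp h1).const_mul
      ((t : ℂ) ^ (w - 1) * ((Real.exp (-t) : ℝ) : ℂ))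
    have e2 : ((Real.exp (-t) : ℝ) : ℂ) * (t : ℂ) ^ (w - μ - 1) =
        (t : ℂ) ^ (w - 1) * ((Real.exp (-t) : ℝ) : ℂ) * ((t ^ (-μ) : ℝ) : ℂ) := ?_
    · rw [e2]; exact h2
    rw [show w - μ - 1 = (w - 1) + ((-μ : ℝ) : ℂ) by push_cast; ring, Complex.cpow_add _ _ ht0,
      Complex.ofReal_cpow ht.le]
    ring

end MTS

namespace MTS

open Filter Topology MeasureTheory

lemma integrableOn_beta {s μ : ℝ} (hs : 0 < s) (hsμ : s < μ) :
    IntegrableOn (fun t : ℝ => t ^ (s - 1) * (1 + t) ^ (-μ)) (Set.Ioi 0) := by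
  have hm : Measurable (fun t : ℝ => t ^ (s - 1) * (1 + t) ^ (-μ)) := by fun_prop
  rw [← Set.Ioc_union_Ioi_eq_Ioi (zero_le_one (α := ℝ))]
  refine IntegrableOn.union ?_ ?_
  · have h1 : IntegrableOn (fun t : ℝ => t ^ (s - 1)) (Set.Ioc 0 1) := by
      rw [← intervalIntegrable_iff_integrableOn_Ioc_of_le zero_le_one]
      exact intervalIntegral.intervalIntegrable_rpow' (by linarith)
    refine Integrable.mono' h1 hm.aestronglyMeasurable ?_
    filter_upwards [ae_restrict_mem measurableSet_Ioc] with t ht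
    have ht0 : 0 < t := ht.1
    rw [Real.norm_of_nonneg (by positivity)]
    exact mul_le_of_le_one_right (by positivity) (one_add_rpow_le (by linarith) ht0)
  · have h1 : IntegrableOn (fun t : ℝ => t ^ (s - 1 + (-μ))) (Set.Ioi 1) :=
      integrableOn_Ioi_rpow_of_lt (by linarith) one_pos
    refine Integrable.mono' h1 hm.aestronglyMeasurable ?_
    filter_upwards [ae_restrict_mem measurableSet_Ioi] with t ht
    have ht : 1 < t := ht
    have ht0 : 0 < t := by linarith
    rw [Real.norm_of_nonneg (by positivity), Real.rpow_add ht0]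
    have h1 : (1 + t) ^ (-μ) ≤ t ^ (-μ) :=
      Real.rpow_le_rpow_of_nonpos ht0 (by linarith) (by linarith)
    gcongr

lemma integral_beta {z : ℂ} {μ : ℝ} (hz : 0 < z.re) (hzμ : z.re < μ) :
    ∫ t in Set.Ioi (0 : ℝ), (t : ℂ) ^ (z - 1) * (((1 + t) ^ (-μ) : ℝ) : ℂ) =
      Complex.Gamma z * Complex.Gamma (μ - z) / Complex.Gamma μ := by
  have hb := Complex.betaIntegral_eq_Gamma_mul_div z (μ - z) hz (by simpa using hzμ)
  rw [show z + (μ - z) = (μ : ℂ) by ring] at hb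
  rw [← hb, Complex.betaIntegral, intervalIntegral.integral_of_le zero_le_one,
    integral_Ioc_eq_integral_Ioo]
  have him : (fun x : ℝ => x / (1 - x)) '' Set.Ioo 0 1 = Set.Ioi 0 := by
    ext y
    constructor
    · rintro ⟨x, hx, rfl⟩
      exact div_pos hx.1 (by linarith [hx.2])
    · intro hy
      have hy : 0 < y := hy
      refine ⟨y / (1 + y), ⟨by positivity, ?_⟩, ?_⟩
      · rw [div_lt_one (by linarith)]; linarith
      · have : 1 + y ≠ 0 := by linarith
        simp only
        rw [show 1 - y / (1 + y) = 1 / (1 + y) by field_simp; ring]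
        field_simp
  rw [← him, integral_image_eq_integral_abs_deriv_smul (f' := fun x => 1 / (1 - x) ^ 2)
    measurableSet_Ioo]
  · refine setIntegral_congr_fun measurableSet_Ioo fun x hx => ?_
    have hx0 : 0 < x := hx.1
    have hx1 : 0 < 1 - x := by linarith [hx.2]
    have hx1c : ((1 - x : ℝ) : ℂ) ≠ 0 := by exact_mod_cast hx1.ne'
    rw [abs_of_pos (by positivity), Complex.real_smul,
      show 1 + x / (1 - x) = (1 - x)⁻¹ by field_simp; ring,
      Real.inv_rpow hx1.le, Real.rpow_neg hx1.le, inv_inv, div_eq_mul_inv x, Complex.ofReal_mul,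
      Complex.mul_cpow_ofReal_nonneg hx0.le (by positivity),
      Complex.ofReal_inv, Complex.inv_cpow, ← Complex.cpow_neg, Complex.ofReal_cpow hx1.le]
    · have e : (((1 / (1 - x) ^ 2 : ℝ)) : ℂ) = ((1 - x : ℝ) : ℂ) ^ (-2 : ℂ) := by
        rw [Complex.cpow_neg]
        have := Complex.cpow_natCast ((1 - x : ℝ) : ℂ) 2
        push_cast at this ⊢
        rw [this, one_div]
      rw [e, show (1 - (x : ℂ)) = ((1 - x : ℝ) : ℂ) by push_cast; ring]
      rw [show (μ : ℂ) - z - 1 = -2 + (-(z - 1)) + μ by ring, Complex.cpow_add _ _ hx1c,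
        Complex.cpow_add _ _ hx1c]
      ring
    · rw [Complex.arg_ofReal_of_nonneg hx1.le]; exact Real.pi_pos.ne
  · intro x hx
    have hx1 : 1 - x ≠ 0 := by linarith [hx.2]
    have := (hasDerivAt_id x).div ((hasDerivAt_id x).const_sub 1) hx1
    refine (this.congr_deriv ?_).hasDerivWithinAt
    simp
  · intro x hx y hy hxy
    have hx1 : 1 - x ≠ 0 := by linarith [hx.2]
    have hy1 : 1 - y ≠ 0 := by linarith [hy.2]
    simp only at hxy
    rw [div_eq_div_iff hx1 hy1] at hxy
    linarith

lemma tendsto_F_zero {z : ℂ} {μ : ℝ} (hz : 0 < z.re) (hzμ : z.re < μ) :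
    Tendsto (fun lam : ℝ => F z μ lam) (𝓝[>] 0)
      (𝓝 (Complex.Gamma z * Complex.Gamma (μ - z) / Complex.Gamma μ)) := by
  rw [← integral_beta hz hzμ]
  unfold F
  refine tendsto_integral_filter_of_dominated_convergence
    (fun t => t ^ (z.re - 1) * (1 + t) ^ (-μ)) ?_ ?_ (integrableOn_beta hz hzμ) ?_
  · exact Eventually.of_forall fun l => (measurable_ker _ _ _).aestronglyMeasurable
  · filter_upwards [self_mem_nhdsWithin] with lam hl
    have hl : 0 < lam := hl
    filter_upwards [ae_restrict_mem measurableSet_Ioi] with t ht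
    have ht : 0 < t := ht
    rw [norm_ker _ _ _ ht]
    have h1 : Real.exp (-lam * t) ≤ 1 := by
      rw [Real.exp_le_one_iff]; nlinarith [mul_pos hl ht]
    gcongr
    exact mul_le_of_le_one_right (by positivity) h1
  · refine Eventually.of_forall fun t => ?_
    have h1 : Continuous (fun lam : ℝ => ker z μ lam t) := by
      unfold ker
      fun_prop
    have := (h1.tendsto 0).mono_left (nhdsWithin_le_nhds (s := Set.Ioi 0))
    simpa [ker] using this

lemma F_ode {z : ℂ} {μ lam : ℝ} (hz : 0 < z.re) (hμ : 0 < μ) (hl : 0 < lam) :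
    lam * F (z + 2) μ lam = (1 + z - μ - lam) * F (z + 1) μ lam + z * F z μ lam := by
  have hz1 : 0 < (z + 1).re := by simp; linarith
  have hz2 : 0 < (z + 2).re := by simp; linarith
  have i0 := (integrable_ker hz hμ hl).const_mul z
  have i1 := (integrable_ker hz1 hμ hl).const_mul (1 + z - μ - lam)
  have i2 := (integrable_ker hz2 hμ hl).const_mul (lam : ℂ)
  have hz0 : z ≠ 0 := by rintro rfl; simp at hz
  have key := integral_Ioi_of_hasDerivAt_of_tendsto (a := 0) (m := (0:ℂ))
    (f := fun t : ℝ => (t : ℂ) ^ z * ((Real.exp (-lam * t) : ℝ) : ℂ) *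
      (((1 + t) ^ (1 - μ) : ℝ) : ℂ))
    (f' := fun t : ℝ => (1 + z - μ - lam) * ker (z + 1) μ lam t + z * ker z μ lam t
      - lam * ker (z + 2) μ lam t) ?_ ?_ ((i1.add i0).sub i2) ?_
  · have e := integral_sub (i1.add i0) i2
    have e' := integral_add i1 i0
    simp only [Pi.add_apply] at e e'
    rw [e, e', integral_const_mul, integral_const_mul, integral_const_mul] at key
    simp only [Complex.ofReal_zero, Complex.zero_cpow hz0, zero_mul, sub_zero] at key
    unfold F
    linear_combination -key
  · apply ContinuousAt.continuousWithinAt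
    have h1 : ContinuousAt (fun t : ℝ => (t : ℂ) ^ z) 0 :=
      Complex.continuousAt_ofReal_cpow_const 0 z (Or.inl hz)
    have h2 : ContinuousAt (fun t : ℝ => (1 + t) ^ (1 - μ)) 0 :=
      ContinuousAt.rpow_const (by fun_prop) (by left; norm_num)
    have h3 : ContinuousAt (fun t : ℝ => (((1 + t) ^ (1 - μ) : ℝ) : ℂ)) 0 :=
      Complex.continuous_ofReal.continuousAt.comp h2
    have h4 : ContinuousAt (fun t : ℝ => ((Real.exp (-lam * t) : ℝ) : ℂ)) 0 := by fun_prop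
    exact (h1.mul h4).mul h3
  · intro t ht
    have ht : 0 < t := ht
    have ht0 : (t : ℂ) ≠ 0 := by exact_mod_cast ht.ne'
    have h1 := hasDerivAt_ofReal_cpow_const' (x := t) (r := z - 1) ht.ne' (by
      intro h; apply hz0; linear_combination h)
    have h1' : HasDerivAt (fun t : ℝ => (t : ℂ) ^ z) (z * (t : ℂ) ^ (z - 1)) t := by
      have := h1.const_mul z
      rw [sub_add_cancel] at this
      have e : (fun t : ℝ => (t : ℂ) ^ z) = fun y : ℝ => z * ((y : ℂ) ^ z / z) := by
        funext y; field_simp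
      rw [e]; exact this
    have h2 : HasDerivAt (fun t : ℝ => Real.exp (-lam * t)) (Real.exp (-lam * t) * (-lam * 1)) t :=
      ((hasDerivAt_id t).const_mul (-lam)).exp
    have h3 : HasDerivAt (fun t : ℝ => (1 + t) ^ (1 - μ)) (1 * (1 - μ) * (1 + t) ^ (1 - μ - 1)) t :=
      ((hasDerivAt_id t).const_add 1).rpow_const (Or.inl (by simp; linarith))
    refine ((h1'.mul h2.ofReal_comp).mul h3.ofReal_comp).congr_deriv ?_
    rw [show z + 2 = z + 1 + 1 by ring, ker_succ (z + 1) _ _ ht, ker_succ z _ _ ht]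
    have hcz : (t : ℂ) ^ z = (t : ℂ) ^ (z - 1) * t := by
      conv_lhs => rw [show z = (z - 1) + 1 by ring, Complex.cpow_add _ _ ht0, Complex.cpow_one]
    have hr : (1 + t) ^ (1 - μ) = (1 + t) ^ (-μ) * (1 + t) := by
      rw [show 1 - μ = -μ + 1 by ring, Real.rpow_add_one (by linarith : (1 + t) ≠ 0)]
    simp only [Pi.mul_apply]
    unfold ker
    rw [hcz, hr, show 1 - μ - 1 = -μ by ring]
    push_cast
    ring
  · rw [tendsto_zero_iff_norm_tendsto_zero]
    have h := tendsto_rpow_mul_exp_neg_mul_atTop_nhds_zero (z.re + 1) lam hl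
    have h' := h.const_mul 2
    rw [mul_zero] at h'
    refine squeeze_zero' (Eventually.of_forall fun t => norm_nonneg _) ?_ h'
    filter_upwards [eventually_ge_atTop 1] with t ht
    have ht0 : 0 < t := by linarith
    rw [norm_mul, norm_mul, Complex.norm_cpow_eq_rpow_re_of_pos ht0, Complex.norm_real,
      Complex.norm_real, Real.norm_of_nonneg (Real.exp_pos _).le,
      Real.norm_of_nonneg (by positivity)]
    have h5 : (1 + t) ^ (1 - μ) ≤ 2 * t := by
      calc (1 + t) ^ (1 - μ) ≤ (1 + t) ^ (1 : ℝ) :=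
            Real.rpow_le_rpow_of_exponent_le (by linarith) (by linarith)
        _ ≤ 2 * t := by rw [Real.rpow_one]; linarith
    rw [Real.rpow_add_one ht0.ne']
    calc _ ≤ t ^ z.re * rexp (-lam * t) * (2 * t) := by gcongr
      _ = _ := by ring

end MTS

namespace MTS

open Filter Topology MeasureTheory

noncomputable def H1 (z : ℂ) (μ x : ℝ) : ℂ := Phi z (μ - z) x

noncomputable def H2 (z : ℂ) (μ x : ℝ) : ℂ := (x : ℂ) ^ ((μ : ℂ) - z) * Phi μ (z - μ) x

noncomputable def G (z : ℂ) (μ x : ℝ) : ℂ := Complex.Gamma μ * F z μ x - H1 z μ x - H2 z μ x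

lemma re_succ {z : ℂ} (hz : 0 < z.re) : 0 < (z + 1).re := by simp; linarith

lemma hasDerivAt_H1 {z : ℂ} {μ : ℝ} (hz : 0 < z.re) (hc : NI (μ - z)) (x : ℝ) :
    HasDerivAt (H1 z μ) (- H1 (z + 1) μ x) x := by
  have := (hasDerivAt_Phi hz hc (x : ℂ)).comp_ofReal
  rw [sub_sub] at this
  exact this

lemma H1_ode {z : ℂ} {μ : ℝ} (hz : 0 < z.re) (hc : NI (μ - z)) (x : ℝ) :
    x * H1 (z + 2) μ x = (1 + z - μ - x) * H1 (z + 1) μ x + z * H1 z μ x := by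
  have h1 := Phi_ii hz hc x
  have h2 := Phi_i (re_succ hz) hc.sub_one x
  unfold H1
  rw [show (μ : ℂ) - (z + 2) = μ - z - 1 - 1 by ring, show (μ : ℂ) - (z + 1) = μ - z - 1 by ring,
    show z + 2 = z + 1 + 1 by ring]
  rw [sub_add_cancel] at h2
  linear_combination h2 - h1

lemma NI.symm {z : ℂ} {μ : ℝ} (hc : NI (μ - z)) : NI (z - μ) := by
  have := hc.neg
  rwa [neg_sub] at this

lemma re_pos {μ : ℝ} (hμ : 0 < μ) : 0 < (μ : ℂ).re := by simpa using hμ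

lemma hasDerivAt_H2 {z : ℂ} {μ : ℝ} (hμ : 0 < μ) (hc : NI (μ - z)) {x : ℝ} (hx : 0 < x) :
    HasDerivAt (H2 z μ) (- H2 (z + 1) μ x) x := by
  have hx0 : (x : ℂ) ≠ 0 := by exact_mod_cast hx.ne'
  have h1 : HasDerivAt (fun t : ℝ => (t : ℂ) ^ ((μ : ℂ) - z))
      (((μ : ℂ) - z) * (x : ℂ) ^ ((μ : ℂ) - z - 1)) x := by
    have := ((hasDerivAt_id (x : ℂ)).cpow_const (c := (μ : ℂ) - z)
      (Complex.ofReal_mem_slitPlane.2 hx)).comp_ofReal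
    simpa using this
  have h2 := (hasDerivAt_Phi (re_pos hμ) hc.symm (x : ℂ)).comp_ofReal
  refine (h1.mul h2).congr_deriv ?_
  have h3 := Phi_i (re_pos hμ) hc.symm (x : ℂ)
  have e : (x : ℂ) ^ ((μ : ℂ) - z) = (x : ℂ) ^ ((μ : ℂ) - z - 1) * x := by
    conv_lhs => rw [show (μ : ℂ) - z = (μ - z - 1) + 1 by ring, Complex.cpow_add _ _ hx0,
      Complex.cpow_one]
  unfold H2
  rw [e, show (μ : ℂ) - (z + 1) = μ - z - 1 by ring, show z + 1 - (μ : ℂ) = z - μ + 1 by ring]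
  linear_combination (- (x : ℂ) ^ ((μ : ℂ) - z - 1)) * h3

lemma H2_ode {z : ℂ} {μ : ℝ} (hμ : 0 < μ) (hc : NI (μ - z)) {x : ℝ} (hx : 0 < x) :
    x * H2 (z + 2) μ x = (1 + z - μ - x) * H2 (z + 1) μ x + z * H2 z μ x := by
  have hx0 : (x : ℂ) ≠ 0 := by exact_mod_cast hx.ne'
  have h1 := Phi_i (re_pos hμ) hc.symm.add_one x
  have h2 := Phi_ii (re_pos hμ) hc.symm x
  have h3 := Phi_i (re_pos hμ) hc.symm x
  rw [add_sub_cancel_right] at h1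
  unfold H2
  rw [show (μ : ℂ) - z = (μ - z - 2) + 1 + 1 by ring,
    show (μ : ℂ) - (z + 1) = (μ - z - 2) + 1 by ring,
    show (μ : ℂ) - (z + 2) = (μ - z - 2) by ring,
    show z + 2 - (μ : ℂ) = z - μ + 1 + 1 by ring,
    show z + 1 - (μ : ℂ) = z - μ + 1 by ring,
    Complex.cpow_add ((μ : ℂ) - z - 2 + 1) _ hx0, Complex.cpow_add _ _ hx0, Complex.cpow_one]
  linear_combination (- (x : ℂ) ^ ((μ : ℂ) - z - 2) * x) * (h1 + x * h2 + x * h3)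

lemma NI.succ {z : ℂ} {μ : ℝ} (hc : NI (μ - z)) : NI (μ - (z + 1)) := by
  rw [← sub_sub]; exact hc.sub_one

lemma hasDerivAt_G {z : ℂ} {μ : ℝ} (hz : 0 < z.re) (hμ : 0 < μ) (hc : NI (μ - z)) {x : ℝ}
    (hx : 0 < x) : HasDerivAt (G z μ) (- G (z + 1) μ x) x := by
  have := (((hasDerivAt_F hz hμ hx).const_mul (Complex.Gamma μ)).sub (hasDerivAt_H1 hz hc x)).sub
    (hasDerivAt_H2 hμ hc hx)
  refine this.congr_deriv ?_
  unfold G; ring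

lemma G_ode {z : ℂ} {μ : ℝ} (hz : 0 < z.re) (hμ : 0 < μ) (hc : NI (μ - z)) {x : ℝ}
    (hx : 0 < x) : 
    x * G (z + 2) μ x = (1 + z - μ - x) * G (z + 1) μ x + z * G z μ x := by
  unfold G
  linear_combination Complex.Gamma μ * F_ode hz hμ hx - H1_ode hz hc x - H2_ode hμ hc hx

lemma G_mu {z : ℂ} {μ : ℝ} (hz : 0 < z.re) (hμ : 0 < μ) (hc : NI (μ - z)) {x : ℝ}
    (hx : 0 < x) : μ * G z μ x = G z (μ + 1) x + G (z + 1) (μ + 1) x := by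
  have hx0 : (x : ℂ) ≠ 0 := by exact_mod_cast hx.ne'
  have hμ0 : (μ : ℂ) ≠ 0 := by exact_mod_cast hμ.ne'
  have h1 := Phi_i hz hc x
  have h2 := Phi_ii hz hc x
  have h3 := Phi_ii (re_pos hμ) hc.symm x
  unfold G H1 H2
  rw [F_mu hz hμ hx]
  push_cast
  rw [Complex.Gamma_add_one _ hμ0,
    show (μ : ℂ) + 1 - (z + 1) = μ - z by ring,
    show (z + 1) - ((μ : ℂ) + 1) = z - μ by ring,
    show (μ : ℂ) + 1 - z = μ - z + 1 by ring,
    show z - ((μ : ℂ) + 1) = z - μ - 1 by ring, Complex.cpow_add _ _ hx0, Complex.cpow_one]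
  linear_combination - h1 - h2 - (x : ℂ) ^ ((μ : ℂ) - z) * h3

def Sol (b z : ℂ) (P0 P1 : ℝ → ℂ) : Prop := ∀ x : ℝ, 0 < x → HasDerivAt P0 (-(P1 x)) x ∧
  ∃ d, HasDerivAt P1 d x ∧ -x * d = (b - x) * P1 x + z * P0 x

lemma const_of_deriv {f : ℝ → ℂ} {L : ℂ} (hf : ∀ x : ℝ, 0 < x → HasDerivAt f 0 x)
    (hL : Tendsto f (𝓝[>] 0) (𝓝 L)) {x : ℝ} (hx : 0 < x) : f x = L := by
  have h : ∀ y : ℝ, 0 < y → f y = f x := fun y hy =>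
    isOpen_Ioi.is_const_of_deriv_eq_zero (𝕜 := ℝ) (s := Set.Ioi (0:ℝ)) (convex_Ioi 0).isPreconnected
      (fun t ht => (hf t ht).differentiableAt.differentiableWithinAt)
      (fun t ht => (hf t ht).deriv) hy hx
  have h2 : Tendsto f (𝓝[>] 0) (𝓝 (f x)) := by
    refine tendsto_const_nhds.congr' ?_
    filter_upwards [self_mem_nhdsWithin] with y hy
    exact (h y hy).symm
  exact tendsto_nhds_unique h2 hL

lemma wronsk {b z : ℂ} {P0 P1 Q0 Q1 : ℝ → ℂ} (hP : Sol b z P0 P1) (hQ : Sol b z Q0 Q1) {L : ℂ}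
    (hL : Tendsto (fun x : ℝ => (x : ℂ) ^ b * (P0 x * Q1 x - P1 x * Q0 x)) (𝓝[>] 0) (𝓝 L))
    {x : ℝ} (hx : 0 < x) :
    ((Real.exp (-x) : ℝ) : ℂ) * ((x : ℂ) ^ b * (P0 x * Q1 x - P1 x * Q0 x)) = L := by
  refine const_of_deriv (f := fun x : ℝ => ((Real.exp (-x) : ℝ) : ℂ) *
    ((x : ℂ) ^ b * (P0 x * Q1 x - P1 x * Q0 x))) ?_ ?_ hx
  · intro x hx
    have hx0 : (x : ℂ) ≠ 0 := by exact_mod_cast hx.ne'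
    obtain ⟨p0, dp, p1, ep⟩ := hP x hx
    obtain ⟨q0, dq, q1, eq⟩ := hQ x hx
    have h1 : HasDerivAt (fun t : ℝ => (t : ℂ) ^ b) (b * (x : ℂ) ^ (b - 1)) x := by
      have := ((hasDerivAt_id (x : ℂ)).cpow_const (c := b)
        (Complex.ofReal_mem_slitPlane.2 hx)).comp_ofReal
      simpa using this
    have h2 : HasDerivAt (fun t : ℝ => ((Real.exp (-t) : ℝ) : ℂ))
        ((Real.exp (-x) * (-1) : ℝ) : ℂ) x := ((hasDerivAt_id x).neg.exp).ofReal_comp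
    refine (h2.mul (h1.mul ((p0.mul q1).sub (p1.mul q0)))).congr_deriv ?_
    have e : (x : ℂ) ^ b = (x : ℂ) ^ (b - 1) * x := by
      conv_lhs => rw [show b = (b - 1) + 1 by ring, Complex.cpow_add _ _ hx0, Complex.cpow_one]
    simp only [Pi.mul_apply, Pi.sub_apply]
    rw [e]
    push_cast
    linear_combination Complex.exp (-x) * (x : ℂ) ^ (b - 1) * (-P0 x * eq + Q0 x * ep)
  · have h2 : Tendsto (fun t : ℝ => ((Real.exp (-t) : ℝ) : ℂ)) (𝓝[>] 0) (𝓝 1) := by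
      have : Continuous (fun t : ℝ => ((Real.exp (-t) : ℝ) : ℂ)) := by fun_prop
      have := (this.tendsto 0).mono_left (nhdsWithin_le_nhds (s := Set.Ioi 0))
      simpa using this
    simpa using h2.mul hL

lemma tendsto_cpow_zero {w : ℂ} (hw : 0 < w.re) :
    Tendsto (fun x : ℝ => (x : ℂ) ^ w) (𝓝[>] 0) (𝓝 0) := by
  have hw0 : w ≠ 0 := by rintro rfl; simp at hw
  have := (Complex.continuousAt_ofReal_cpow_const 0 w (Or.inl hw)).tendsto.mono_left
    (nhdsWithin_le_nhds (s := Set.Ioi 0))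
  simpa [Complex.zero_cpow hw0] using this

lemma tendsto_cpow_mul {w : ℂ} (hw : 0 ≤ w.re) {f : ℝ → ℂ} (hf : Tendsto f (𝓝[>] 0) (𝓝 0)) :
    Tendsto (fun x : ℝ => (x : ℂ) ^ w * f x) (𝓝[>] 0) (𝓝 0) := by
  rw [tendsto_zero_iff_norm_tendsto_zero] at hf ⊢
  refine squeeze_zero' (Eventually.of_forall fun t => norm_nonneg _) ?_ hf
  filter_upwards [Ioo_mem_nhdsGT (zero_lt_one (α := ℝ))] with x hx
  rw [norm_mul, Complex.norm_cpow_eq_rpow_re_of_pos hx.1]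
  exact mul_le_of_le_one_left (norm_nonneg _) (Real.rpow_le_one hx.1.le hx.2.le hw)

lemma tendsto_Phi {a c : ℂ} (ha : 0 < a.re) (hc : NI c) :
    Tendsto (fun x : ℝ => Phi a c x) (𝓝[>] 0) (𝓝 (Complex.Gamma a * Complex.Gamma c)) := by
  have h : Continuous (fun x : ℝ => Phi a c x) :=
    (continuous_Phi ha hc).comp Complex.continuous_ofReal
  have := (h.tendsto 0).mono_left (nhdsWithin_le_nhds (s := Set.Ioi 0))
  simpa [Phi_zero] using this

lemma tendsto_H2_zero {z : ℂ} {μ : ℝ} (hμ : 0 < μ) (hc : NI (μ - z)) (hre : z.re < μ) :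
    Tendsto (H2 z μ) (𝓝[>] 0) (𝓝 0) := by
  have h := (tendsto_cpow_zero (w := μ - z) (by simpa using hre)).mul
    (tendsto_Phi (re_pos hμ) hc.symm)
  rw [zero_mul] at h
  exact h

lemma NI.Gamma_ne {c : ℂ} (hc : NI c) : Complex.Gamma c ≠ 0 := by
  apply Complex.Gamma_ne_zero
  intro m
  have := hc (-m)
  push_cast at this
  exact this

lemma tendsto_G_zero {z : ℂ} {μ : ℝ} (hz : 0 < z.re) (hμ : 0 < μ) (hc : NI (μ - z))
    (hre : z.re < μ) : Tendsto (G z μ) (𝓝[>] 0) (𝓝 0) := by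
  have h1 := ((tendsto_F_zero hz hre).const_mul (Complex.Gamma μ)).sub (tendsto_Phi hz hc)
  have h2 := h1.sub (tendsto_H2_zero hμ hc hre)
  have hg : Complex.Gamma μ ≠ 0 := Complex.Gamma_ne_zero_of_re_pos (re_pos hμ)
  rw [mul_div_cancel₀ _ hg, sub_self, sub_zero] at h2
  exact h2

lemma base {z : ℂ} {μ : ℝ} (hz : 0 < z.re) (hμ : 0 < μ) (hc : NI (μ - z))
    (hre : z.re < μ) (hre' : μ ≤ z.re + 1) {x : ℝ} (hx : 0 < x) : G z μ x = 0 := by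
  set b : ℂ := 1 + z - μ with hb
  have hbre : 0 ≤ b.re := by simp [hb]; linarith
  have hbNI : NI b := by
    have := hc.symm.add_one
    rwa [show z - (μ : ℂ) + 1 = b by rw [hb]; ring] at this
  have hz1 := re_succ hz
  have hcpow_ne : ∀ (x : ℝ) (w : ℂ), 0 < x → (x : ℂ) ^ w * (x : ℂ) ^ (-w) = 1 := by
    intro x w hx
    have hx0 : (x : ℂ) ≠ 0 := by exact_mod_cast hx.ne'
    rw [← Complex.cpow_add _ _ hx0, add_neg_cancel, Complex.cpow_zero]
  have G0 := tendsto_G_zero hz hμ hc hre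
  have hb1 : 0 < (b + 1).re := by simp; linarith [hbre]
  have T2 : Tendsto (fun x : ℝ => (x : ℂ) ^ (b + 1) * G (z + 2) μ x) (𝓝[>] 0) (𝓝 0) := by
    have eb : z + 2 - (μ : ℂ) = b + 1 := by rw [hb]; ring
    have f2 := (tendsto_F_scale (w := z + 2) hμ (by rw [eb]; exact hb1)).const_mul
      (Complex.Gamma μ)
    have f1 := (tendsto_cpow_zero hb1).mul
      (tendsto_Phi (a := z + 2) (c := μ - (z + 2)) (by simp; linarith) (by
        have := hc.succ.succ
        rwa [show z + 1 + 1 = z + 2 by ring] at this))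
    have f3 := tendsto_Phi (re_pos hμ) hbNI.add_one
    have h := (f2.sub f1).sub f3
    rw [eb, zero_mul, sub_zero, sub_self] at h
    refine h.congr' ?_
    filter_upwards [self_mem_nhdsWithin] with x hx
    have := hcpow_ne x (b + 1) hx
    unfold G H1 H2
    rw [eb, show (μ : ℂ) - (z + 2) = -(b + 1) by rw [hb]; ring]
    linear_combination (Phi μ (b + 1) x) * this
  have T1 : Tendsto (fun x : ℝ => (x : ℂ) ^ b * G (z + 1) μ x) (𝓝[>] 0) (𝓝 0) := by
    have h := T2.sub ((tendsto_cpow_mul hbre G0).const_mul z)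
    have hbx : Tendsto (fun x : ℝ => b - x) (𝓝[>] 0) (𝓝 b) := by
      have : Continuous (fun t : ℝ => b - t) := by fun_prop
      have := (this.tendsto 0).mono_left (nhdsWithin_le_nhds (s := Set.Ioi 0))
      simpa using this
    have h' := h.div hbx hbNI.ne_zero
    rw [mul_zero, sub_zero, zero_div] at h'
    refine h'.congr' ?_
    filter_upwards [self_mem_nhdsWithin, hbx.eventually_ne hbNI.ne_zero] with x hx hne
    have hx : 0 < x := hx
    have hx0 : (x : ℂ) ≠ 0 := by exact_mod_cast hx.ne'
    have ode := G_ode hz hμ hc hx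
    rw [← hb] at ode
    simp only [Pi.div_apply]
    rw [div_eq_iff hne, Complex.cpow_add _ _ hx0, Complex.cpow_one]
    linear_combination (x : ℂ) ^ b * ode
  have A0 : Tendsto (H1 z μ) (𝓝[>] 0) (𝓝 (Complex.Gamma z * Complex.Gamma (μ - z))) :=
    tendsto_Phi hz hc
  have A1 : Tendsto (H1 (z + 1) μ) (𝓝[>] 0) (𝓝 _) := tendsto_Phi hz1 hc.succ
  have B0 := tendsto_H2_zero hμ hc hre
  have B1 : Tendsto (fun x : ℝ => (x : ℂ) ^ b * H2 (z + 1) μ x) (𝓝[>] 0)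
      (𝓝 (Complex.Gamma μ * Complex.Gamma b)) := by
    refine (tendsto_Phi (re_pos hμ) hbNI).congr' ?_
    filter_upwards [self_mem_nhdsWithin] with x hx
    have := hcpow_ne x b hx
    unfold H2
    rw [show (μ : ℂ) - (z + 1) = -b by rw [hb]; ring, show z + 1 - (μ : ℂ) = b by rw [hb]; ring]
    linear_combination -(Phi μ b x) * this
  have e2 : z + 1 + 1 = z + 2 := by ring
  have SG : Sol b z (G z μ) (G (z + 1) μ) := fun x hx =>
    ⟨hasDerivAt_G hz hμ hc hx, _, hasDerivAt_G hz1 hμ hc.succ hx, by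
      rw [e2, neg_mul_neg]; exact G_ode hz hμ hc hx⟩
  have S1 : Sol b z (H1 z μ) (H1 (z + 1) μ) := fun x hx =>
    ⟨hasDerivAt_H1 hz hc x, _, hasDerivAt_H1 hz1 hc.succ x, by
      rw [e2, neg_mul_neg]; exact H1_ode hz hc x⟩
  have S2 : Sol b z (H2 z μ) (H2 (z + 1) μ) := fun x hx =>
    ⟨hasDerivAt_H2 hμ hc hx, _, hasDerivAt_H2 hμ hc.succ hx, by
      rw [e2, neg_mul_neg]; exact H2_ode hμ hc hx⟩
  have W1 := wronsk SG S1 (L := 0) (by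
    have h := (tendsto_cpow_mul hbre (f := fun x => G z μ x * H1 (z + 1) μ x) (by
      simpa using G0.mul A1)).sub (T1.mul A0)
    rw [zero_mul, sub_zero] at h
    refine h.congr fun x => ?_
    ring) hx
  have W2 := wronsk SG S2 (L := 0) (by
    have h := (G0.mul B1).sub (T1.mul B0)
    rw [zero_mul, zero_mul, sub_zero] at h
    refine h.congr fun x => ?_
    ring) hx
  have W3 := wronsk S1 S2 (by
    have h := (A0.mul B1).sub (tendsto_cpow_mul hbre (f := fun x => H1 (z + 1) μ x * H2 z μ x) (by
      simpa using A1.mul B0))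
    rw [sub_zero] at h
    refine h.congr fun x => ?_
    ring) hx
  have hne : Complex.Gamma z * Complex.Gamma (μ - z) * (Complex.Gamma μ * Complex.Gamma b) ≠ 0 :=
    mul_ne_zero (mul_ne_zero (Complex.Gamma_ne_zero_of_re_pos hz) hc.Gamma_ne)
      (mul_ne_zero (Complex.Gamma_ne_zero_of_re_pos (re_pos hμ)) hbNI.Gamma_ne)
  have : G z μ x * (Complex.Gamma z * Complex.Gamma (μ - z) * (Complex.Gamma μ * Complex.Gamma b))
      = 0 := by
    linear_combination (-G z μ x) * W3 + H1 z μ x * W2 - H2 z μ x * W1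
  exact (mul_eq_zero.1 this).resolve_right hne

lemma G_up (n : ℕ) : ∀ (z : ℂ) (μ : ℝ), 0 < z.re → 0 < μ → NI (μ - z) → z.re < μ →
    μ ≤ z.re + 1 + n → ∀ x : ℝ, 0 < x → G z μ x = 0 := by
  induction n with
  | zero =>
    intro z μ hz hμ hc hre hre' x hx
    exact base hz hμ hc hre (by simpa using hre') hx
  | succ n ih =>
    intro z μ hz hμ hc hre hre' x hx
    push_cast at hre'
    by_cases h : μ ≤ z.re + 1
    · exact base hz hμ hc hre h hx
    · push Not at h
      refine const_of_deriv (fun y hy => ?_) (tendsto_G_zero hz hμ hc hre) hx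
      have h0 := ih (z + 1) μ (re_succ hz) hμ hc.succ (by simpa using h) (by simp; linarith) y hy
      have := hasDerivAt_G hz hμ hc hy
      rwa [h0, neg_zero] at this

lemma G_down (n : ℕ) : ∀ (z : ℂ) (μ : ℝ), 0 < z.re → 0 < μ → NI (μ - z) → z.re < μ + n →
    ∀ x : ℝ, 0 < x → G z μ x = 0 := by
  induction n with
  | zero =>
    intro z μ hz hμ hc hre x hx
    obtain ⟨m, hm⟩ := exists_nat_gt (μ - z.re - 1)
    exact G_up m z μ hz hμ hc (by simpa using hre) (by linarith) x hx
  | succ n ih =>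
    intro z μ hz hμ hc hre x hx
    push_cast at hre
    have hc' : NI (((μ + 1 : ℝ) : ℂ) - z) := by
      have := hc.add_one
      push_cast
      rwa [show (μ : ℂ) + 1 - z = μ - z + 1 by ring]
    have hμ1 : 0 < μ + 1 := by linarith
    have h0 : ∀ y : ℝ, 0 < y → G z (μ + 1) y = 0 := ih z (μ + 1) hz hμ1 hc' (by linarith)
    have h1 := hasDerivAt_G hz hμ1 hc' hx
    have h2 : HasDerivAt (G z (μ + 1)) 0 x := by
      refine (hasDerivAt_const x (0 : ℂ)).congr_of_eventuallyEq ?_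
      filter_upwards [Ioi_mem_nhds hx] with y hy
      exact h0 y hy
    have h3 := neg_eq_zero.1 (h1.unique h2)
    have h4 := G_mu hz hμ hc hx
    rw [h3, h0 x hx, add_zero] at h4
    have hμ0 : (μ : ℂ) ≠ 0 := by exact_mod_cast hμ.ne'
    exact (mul_eq_zero.1 h4).resolve_left hμ0

lemma G_eq_zero {z : ℂ} {μ : ℝ} (hz : 0 < z.re) (hμ : 0 < μ) (hc : NI (μ - z)) {x : ℝ}
    (hx : 0 < x) : G z μ x = 0 := by
  obtain ⟨m, hm⟩ := exists_nat_gt (z.re - μ)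
  exact G_down m z μ hz hμ hc (by linarith) x hx

lemma integral_sq (w : ℂ) (μ lam : ℝ) :
    (∫ x in Set.Ioi (0 : ℝ), (x : ℂ) ^ (2 * w - 1) *
        ((Real.exp (-lam * x ^ 2) : ℝ) : ℂ) * (((1 + x ^ 2) ^ (-μ) : ℝ) : ℂ)) = 1 / 2 * F w μ lam := by
  have h := integral_comp_rpow_Ioi (ker w μ lam) (p := 2) two_ne_zero
  unfold F
  rw [← h, ← integral_const_mul]
  refine setIntegral_congr_fun measurableSet_Ioi fun x hx => ?_
  have hx : 0 < x := hx
  have hx0 : (x : ℂ) ≠ 0 := by exact_mod_cast hx.ne'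
  simp only [ker]
  have e1 : x ^ (2 : ℝ) = x ^ 2 := by exact_mod_cast Real.rpow_natCast x 2
  have e2 : (((x ^ 2 : ℝ)) : ℂ) ^ (w - 1) = (x : ℂ) ^ (w - 1) * (x : ℂ) ^ (w - 1) := by
    rw [pow_two, Complex.ofReal_mul, Complex.mul_cpow_ofReal_nonneg hx.le hx.le]
  rw [e1, e2, show (2 : ℝ) - 1 = 1 by norm_num, Real.rpow_one, Complex.real_smul,
    show 2 * w - 1 = (w - 1) + (w - 1) + 1 by ring, Complex.cpow_add _ _ hx0,
    Complex.cpow_add _ _ hx0, Complex.cpow_one]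
  simp only [Nat.abs_ofNat]
  push_cast
  ring

end MTS

theorem mellin_transform_splitting (lam : ℝ) (hlam : 0 < lam) (μ : ℝ) (hμ : 0 < μ)
    (γ : ℝ) (s : ℂ) (hre : 0 < ((γ : ℂ) + s).re)
    (z : ℂ) (hz : z = ((γ : ℂ) + s) / 2)
    (hzμ : ∀ n : ℤ, z - (μ : ℂ) ≠ (n : ℂ)) :
    Summable (fun n : ℕ => ‖(ascPochhammer ℂ n).eval z * (lam : ℂ) ^ n
        / ((ascPochhammer ℂ n).eval (1 + z - (μ : ℂ)) * (n.factorial : ℂ))‖) ∧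
    Summable (fun n : ℕ => ‖(ascPochhammer ℂ n).eval (μ : ℂ) * (lam : ℂ) ^ n
        / ((ascPochhammer ℂ n).eval (1 - z + (μ : ℂ)) * (n.factorial : ℂ))‖) ∧
    (∫ x in Set.Ioi (0 : ℝ), (x : ℂ) ^ ((γ : ℂ) + s - 1) *
        (Real.exp (-lam * x ^ 2) : ℂ) * (((1 + x ^ 2) ^ (-μ) : ℝ) : ℂ))
      = 1 / 2 * (Complex.Gamma z * Complex.Gamma ((μ : ℂ) - z) / Complex.Gamma (μ : ℂ) *
            ∑' n : ℕ, (ascPochhammer ℂ n).eval z * (lam : ℂ) ^ n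
              / ((ascPochhammer ℂ n).eval (1 + z - (μ : ℂ)) * (n.factorial : ℂ))
          + (lam : ℂ) ^ ((μ : ℂ) - z) * Complex.Gamma (z - (μ : ℂ)) *
            ∑' n : ℕ, (ascPochhammer ℂ n).eval (μ : ℂ) * (lam : ℂ) ^ n
              / ((ascPochhammer ℂ n).eval (1 - z + (μ : ℂ)) * (n.factorial : ℂ))) := by
  have hNI' : MTS.NI (z - μ) := hzμ
  have hNI : MTS.NI (μ - z) := by
    have := hNI'.neg
    rwa [neg_sub] at this
  have hzre : 0 < z.re := by
    rw [hz, show ((γ : ℂ) + s) / 2 = ((γ : ℂ) + s) / ((2 : ℝ) : ℂ) by norm_num,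
      Complex.div_ofReal_re]
    linarith
  have key : ∀ (a c d : ℂ), 0 < a.re → MTS.NI c → 1 - c = d →
      Summable (fun n : ℕ => ‖(ascPochhammer ℂ n).eval a * (lam : ℂ) ^ n
        / ((ascPochhammer ℂ n).eval d * (n.factorial : ℂ))‖) ∧
      MTS.Phi a c lam = Complex.Gamma a * Complex.Gamma c *
        ∑' n : ℕ, (ascPochhammer ℂ n).eval a * (lam : ℂ) ^ n
        / ((ascPochhammer ℂ n).eval d * (n.factorial : ℂ)) := by
    intro a c d ha hc hd
    subst hd
    have hne : Complex.Gamma a * Complex.Gamma c ≠ 0 :=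
      mul_ne_zero (Complex.Gamma_ne_zero_of_re_pos ha) hc.Gamma_ne
    have e : (fun n : ℕ => MTS.g a c n * (lam : ℂ) ^ n) = fun n : ℕ =>
        Complex.Gamma a * Complex.Gamma c * ((ascPochhammer ℂ n).eval a * (lam : ℂ) ^ n
        / ((ascPochhammer ℂ n).eval (1 - c) * (n.factorial : ℂ))) := by
      funext n
      rw [MTS.g_poch ha hc]; ring
    constructor
    · have h := MTS.summable_g ha hc (lam : ℂ)
      rw [e] at h
      exact ((summable_mul_left_iff hne).1 h).norm
    · unfold MTS.Phi
      rw [e, tsum_mul_left]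
  obtain ⟨s1, k1⟩ := key z (μ - z) (1 + z - μ) hzre hNI (by ring)
  obtain ⟨s2, k2⟩ := key μ (z - μ) (1 - z + μ) (MTS.re_pos hμ) hNI' (by ring)
  refine ⟨s1, s2, ?_⟩
  have hG := MTS.G_eq_zero hzre hμ hNI hlam
  unfold MTS.G MTS.H1 MTS.H2 at hG
  rw [k1, k2] at hG
  have hI := MTS.integral_sq z μ lam
  rw [show 2 * z - 1 = (γ : ℂ) + s - 1 by rw [hz]; ring] at hI
  have hg : Complex.Gamma μ ≠ 0 := Complex.Gamma_ne_zero_of_re_pos (MTS.re_pos hμ)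
  rw [hI]
  congr 1
  field_simp
  linear_combination hG
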